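/- Let M₀ and M₁ be single-tape alternating Turing machines over the same input alphabet Σ and machine alphabet Γ, and let M be their combined two-tape machine. If M₁ rejects a configuration (q₁,u₁) and (q₀,u₀) is a configuration of M₀ that is not accepted by M₀, then M rejects the configuration (⟨q₀,q₁,1⟩, ⟨u₀,u₁⟩). -/

import Mathlib

namespace ATMPaper

/-- Actions of a Turing machine: overwrite the scanned symbol by a letter,
move the cursor backward (`left`), or forward (`right`). -/
inductive Act (Γ : Type) : Type
  | write : Γ → Act Γ
  | left : Act Γ
  | right : Act Γ

/-- A cursored tape `u γ̲ v`: the string `u` to the left of the cursor,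
the scanned symbol `γ`, and the string `v` to the right. -/
abbrev Tape (Γ : Type) : Type := List Γ × Γ × List Γ

/-- The scanned symbol of a cursored tape. -/
def Tape.scan {Γ : Type} (t : Tape Γ) : Γ := t.2.1

/-- The effect of an action on a cursored tape (with blank symbol `blank`):
moving forward past the right end extends the tape with a blank, and moving
backward at the left end leaves the cursor in place. -/
inductive ActStep {Γ : Type} (blank : Γ) : Act Γ → Tape Γ → Tape Γ → Prop
  | fwd (u : List Γ) (γ τ : Γ) (v : List Γ) :
      ActStep blank Act.right (u, γ, τ :: v) (u ++ [γ], τ, v)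
  | fwdEnd (u : List Γ) (γ : Γ) :
      ActStep blank Act.right (u, γ, []) (u ++ [γ], blank, [])
  | bwd (u : List Γ) (τ γ : Γ) (v : List Γ) :
      ActStep blank Act.left (u ++ [τ], γ, v) (u, τ, γ :: v)
  | bwdEnd (γ : Γ) (v : List Γ) :
      ActStep blank Act.left ([], γ, v) ([], γ, v)
  | write (u : List Γ) (γ τ : Γ) (v : List Γ) :
      ActStep blank (Act.write τ) (u, γ, v) (u, τ, v)

section Generic

variable {C : Type*} (isE : C → Bool) (step : C → C → Prop)

/-- A chain of steps `c = c₀ → ⋯ → cₙ = c'` (`n ≥ 0`) in which `c₀,…,cₙ₋₁`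
are all existential. -/
inductive EChain : C → C → Prop
  | refl (c : C) : EChain c c
  | step {c c' c'' : C} : isE c = true → step c c' → EChain c' c'' → EChain c c''

/-- A chain of steps `c = c₀ → ⋯ → cₙ = c'` (`n ≥ 0`) in which `c₀,…,cₙ₋₁`
are all universal. -/
inductive UChain : C → C → Prop
  | refl (c : C) : UChain c c
  | step {c c' c'' : C} : isE c = false → step c c' → UChain c' c'' → UChain c c''

/-- `c ⇑∃ c'` : `c'` is universal and reachable from `c` by a chain passing
only through existential configurations. -/
def EPivot (c c' : C) : Prop := EChain isE step c c' ∧ isE c' = false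

/-- `c ⇑∀ c'` : `c'` is existential and reachable from `c` by a chain passing
only through universal configurations. -/
def UPivot (c c' : C) : Prop := UChain isE step c c' ∧ isE c' = true

/-- The set `AC` of accepted configurations: the least set `S` such that
(i) an existential `c` with some pivot `c ⇑∃ c'`, `c' ∈ S`, is in `S`, and
(ii) a universal `c` all of whose pivots `c ⇑∀ c'` lie in `S` is in `S`. -/
inductive Accepted : C → Prop
  | ex {c c' : C} : isE c = true → EPivot isE step c c' → Accepted c' → Accepted c
  | univ {c : C} : isE c = false → (∀ c', UPivot isE step c c' → Accepted c') →
      Accepted c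

/-- The set `RC` of rejected configurations: the least set `S` such that
(i) an existential `c` all of whose pivots `c ⇑∃ c'` lie in `S` is in `S`, and
(ii) a universal `c` with some pivot `c ⇑∀ c'`, `c' ∈ S`, is in `S`. -/
inductive Rejected : C → Prop
  | ex {c : C} : isE c = true → (∀ c', EPivot isE step c c' → Rejected c') →
      Rejected c
  | univ {c c' : C} : isE c = false → UPivot isE step c c' → Rejected c' →
      Rejected c

end Generic

/-- An alternating Turing machine over input alphabet `α`, with (finite)
machine alphabet `Γ` into which `α` embeds, a blank symbol (not a letter
of `α`), a finite set `Q` of states each of which is existential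
(`isE q = true`) or universal (`isE q = false`), a start state, and a
transition relation `δ`. -/
structure ATM (α Γ : Type) where
  ΓFin : Finite Γ
  emb : α ↪ Γ
  blank : Γ
  blank_ne : ∀ a : α, emb a ≠ blank
  Q : Type
  QFin : Finite Q
  isE : Q → Bool
  start : Q
  δ : Q → Γ → Act Γ → Q → Prop

namespace ATM

variable {α Γ : Type} (M : ATM α Γ)

/-- A configuration: a state together with a cursored tape. -/
abbrev Cfg : Type := M.Q × Tape Γ

/-- A configuration is existential or universal according to its state. -/
def cfgE (c : M.Cfg) : Bool := M.isE c.1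

/-- The one-step yield relation between configurations. -/
def Yield (c c' : M.Cfg) : Prop :=
  ∃ a : Act Γ, M.δ c.1 (Tape.scan c.2) a c'.1 ∧ ActStep M.blank a c.2 c'.2

/-- `c ⇑∃ c'` for configurations of `M`. -/
def EPiv (c c' : M.Cfg) : Prop := ATMPaper.EPivot M.cfgE M.Yield c c'

/-- `c ⇑∀ c'` for configurations of `M`. -/
def UPiv (c c' : M.Cfg) : Prop := ATMPaper.UPivot M.cfgE M.Yield c c'

/-- `c` is an accepted configuration of `M`. -/
def Accepted (c : M.Cfg) : Prop := ATMPaper.Accepted M.cfgE M.Yield c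

/-- `c` is a rejected configuration of `M`. -/
def Rejected (c : M.Cfg) : Prop := ATMPaper.Rejected M.cfgE M.Yield c

/-- The initial configuration `(s₀, ε, ⊔, w)` for input `w`. -/
def init (w : List α) : M.Cfg := (M.start, ([], M.blank, w.map M.emb))

/-- `M` accepts the input string `w`. -/
def Accepts (w : List α) : Prop := M.Accepted (M.init w)

/-- `M` rejects the input string `w`. -/
def Rejects (w : List α) : Prop := M.Rejected (M.init w)

/-- The language `L(M)` accepted by `M`. -/
def Lang : Set (List α) := {w | M.Accepts w}

/-- The language `L̄(M)` rejected by `M`. -/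
def coLang : Set (List α) := {w | M.Rejects w}

/-- `M` is total: every input is either accepted or rejected. -/
def Total : Prop := ∀ w : List α, M.Accepts w ∨ M.Rejects w

/-- `M` is one-sided: it has no accepted configurations, or no rejected ones. -/
def OneSided : Prop :=
  (∀ c : M.Cfg, ¬ M.Accepted c) ∨ (∀ c : M.Cfg, ¬ M.Rejected c)

/-- The dual machine: same data, with existential and universal states
interchanged. -/
def dual : ATM α Γ :=
  ⟨M.ΓFin, M.emb, M.blank, M.blank_ne, M.Q, M.QFin,
    fun q => !M.isE q, M.start, M.δ⟩

/-- `M` is alternation well-founded: for no input `w` is there an infinite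
sequence of yield-steps from the initial configuration for `w` in which the
type (existential/universal) changes infinitely often. -/
def AltWF : Prop :=
  ∀ w : List α, ¬∃ d : ℕ → M.Cfg, d 0 = M.init w ∧
    (∀ i : ℕ, M.Yield (d i) (d (i + 1))) ∧
    (∀ n : ℕ, ∃ m : ℕ, n ≤ m ∧ M.cfgE (d m) ≠ M.cfgE (d (m + 1)))

/-- Every chain of yield-steps from an initial configuration of `M` has at
most `k` alternation-pivots, i.e. at most `k` indices at which the type of
the configuration changes. -/
def AltBound (k : ℕ) : Prop :=
  ∀ (w : List α) (n : ℕ) (d : ℕ → M.Cfg), d 0 = M.init w →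
    (∀ i < n, M.Yield (d i) (d (i + 1))) →
    ((Finset.range n).filter fun i => M.cfgE (d i) ≠ M.cfgE (d (i + 1))).card ≤ k

/-- `M` is a `Σ_k` machine: its start state is existential and every chain of
yield-steps from an initial configuration has at most `k` alternation-pivots. -/
def IsSigmaM (k : ℕ) : Prop := M.isE M.start = true ∧ M.AltBound k

/-- `M` is a `Π_k` machine: its start state is universal and every chain of
yield-steps from an initial configuration has at most `k` alternation-pivots;
moreover for `k = 1` no transition rule applies to any existential state. -/
def IsPiM (k : ℕ) : Prop :=
  M.isE M.start = false ∧ M.AltBound k ∧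
    (k = 1 → ∀ (q : M.Q) (γ : Γ) (a : Act Γ) (q' : M.Q),
      M.δ q γ a q' → M.isE q = false)

end ATM

/-- `AltQuant α k b P` is the statement `Q₁ x₁ Q₂ x₂ ⋯ Q_k x_k, P (x₁,…,x_k)`
where the quantifiers `Qᵢ` over `List α` alternate, starting with `∃` if
`b = true` and with `∀` if `b = false`. -/
def AltQuant (α : Type) : (k : ℕ) → Bool → ((Fin k → List α) → Prop) → Prop
  | 0, _, P => P fun i => i.elim0
  | k + 1, true, P => ∃ x : List α, AltQuant α k false fun v => P (Fin.cons x v)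
  | k + 1, false, P => ∀ x : List α, AltQuant α k true fun v => P (Fin.cons x v)

/-- `L ⊆ Σ*` is `Σ⁰_k`: definable by `k` alternating quantifiers over strings,
beginning with `∃`, applied to a computable relation. -/
def IsSigma0 (α : Type) [Primcodable α] (k : ℕ) (L : Set (List α)) : Prop :=
  ∃ R : List α × (Fin k → List α) → Prop, ComputablePred R ∧
    L = {w | AltQuant α k true fun v => R (w, v)}

/-- `L ⊆ Σ*` is `Π⁰_k`: definable by `k` alternating quantifiers over strings,
beginning with `∀`, applied to a computable relation. -/
def IsPi0 (α : Type) [Primcodable α] (k : ℕ) (L : Set (List α)) : Prop :=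
  ∃ R : List α × (Fin k → List α) → Prop, ComputablePred R ∧
    L = {w | AltQuant α k false fun v => R (w, v)}

/-- `L ⊆ Σ*` is inductive (`Π¹₁`): there is a computable relation
`R ⊆ Σ* × List (Σ*)` with
`L = {w | ∀ f : ℕ → Σ*, ∃ n, R (w, [f 0, …, f n])}`. -/
def IsInductive (α : Type) [Primcodable α] (L : Set (List α)) : Prop :=
  ∃ R : List α × List (List α) → Prop, ComputablePred R ∧
    L = {w | ∀ f : ℕ → List α, ∃ n : ℕ, R (w, (List.range (n + 1)).map f)}

/-- A two-tape alternating Turing machine: as `ATM`, but configurations carry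
two cursored tapes, and transitions read both scanned symbols and perform an
action on each tape. -/
structure ATM2 (α Γ : Type) where
  ΓFin : Finite Γ
  emb : α ↪ Γ
  blank : Γ
  blank_ne : ∀ a : α, emb a ≠ blank
  Q : Type
  QFin : Finite Q
  isE : Q → Bool
  start : Q
  δ : Q → Γ → Γ → Act Γ → Act Γ → Q → Prop

namespace ATM2

variable {α Γ : Type} (M : ATM2 α Γ)

/-- A configuration of a two-tape machine: a state and two cursored tapes. -/
abbrev Cfg : Type := M.Q × Tape Γ × Tape Γ

/-- A configuration is existential or universal according to its state. -/
def cfgE (c : M.Cfg) : Bool := M.isE c.1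

/-- The one-step yield relation of a two-tape machine. -/
def Yield (c c' : M.Cfg) : Prop :=
  ∃ a₀ a₁ : Act Γ, M.δ c.1 (Tape.scan c.2.1) (Tape.scan c.2.2) a₀ a₁ c'.1 ∧
    ActStep M.blank a₀ c.2.1 c'.2.1 ∧ ActStep M.blank a₁ c.2.2 c'.2.2

/-- `c ⇑∃ c'` for configurations of `M`. -/
def EPiv (c c' : M.Cfg) : Prop := ATMPaper.EPivot M.cfgE M.Yield c c'

/-- `c ⇑∀ c'` for configurations of `M`. -/
def UPiv (c c' : M.Cfg) : Prop := ATMPaper.UPivot M.cfgE M.Yield c c'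

/-- `c` is an accepted configuration of `M`. -/
def Accepted (c : M.Cfg) : Prop := ATMPaper.Accepted M.cfgE M.Yield c

/-- `c` is a rejected configuration of `M`. -/
def Rejected (c : M.Cfg) : Prop := ATMPaper.Rejected M.cfgE M.Yield c

/-- `M` accepts `w`: the configuration reached after the (deterministic)
pre-processing phase — the start state with the input copied onto both
tapes — is accepted. -/
def Accepts (w : List α) : Prop :=
  M.Accepted (M.start, ([], M.blank, w.map M.emb), ([], M.blank, w.map M.emb))

/-- `M` rejects `w`. -/
def Rejects (w : List α) : Prop :=
  M.Rejected (M.start, ([], M.blank, w.map M.emb), ([], M.blank, w.map M.emb))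

end ATM2

/-- The combined two-tape machine `M` of two single-tape machines `M₀`, `M₁`
over a common alphabet. Its states are triples `⟨q₀,q₁,j⟩` (`j : Bool`, with
`false` for `0` and `true` for `1`), typed according to `q_j`. In control
`j = 0`, a rule `(q₀,γ₀,a,p₀)` of `M₀` acts by `a` on tape `0`, leaves tape `1`
unchanged (re-writing its scanned symbol), and passes to control `0` if `q₀`
and `p₀` are both universal, and to control `1` otherwise; symmetrically, in
control `j = 1`, a rule `(q₁,γ₁,a,p₁)` of `M₁` acts by `a` on tape `1`, leaves
tape `0` unchanged, and passes to control `1` if `q₁` and `p₁` are both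
existential, and to control `0` otherwise. -/
def combine {α Γ : Type} (M₀ M₁ : ATM α Γ) : ATM2 α Γ where
  ΓFin := M₀.ΓFin
  emb := M₀.emb
  blank := M₀.blank
  blank_ne := M₀.blank_ne
  Q := M₀.Q × M₁.Q × Bool
  QFin := by haveI := M₀.QFin; haveI := M₁.QFin; infer_instance
  isE := fun s => cond s.2.2 (M₁.isE s.2.1) (M₀.isE s.1)
  start := (M₀.start, M₁.start, false)
  δ := fun s γ₀ γ₁ a₀ a₁ p =>
    (s.2.2 = false ∧ ∃ p₀ : M₀.Q, M₀.δ s.1 γ₀ a₀ p₀ ∧ a₁ = Act.write γ₁ ∧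
        p = (p₀, s.2.1, !(!(M₀.isE s.1) && !(M₀.isE p₀)))) ∨
    (s.2.2 = true ∧ ∃ p₁ : M₁.Q, M₁.δ s.2.1 γ₁ a₁ p₁ ∧ a₀ = Act.write γ₀ ∧
        p = (s.1, p₁, M₁.isE s.2.1 && M₁.isE p₁))

end ATMPaper

namespace ATMPaper

section Generic

variable {C : Type*} {isE : C → Bool} {step : C → C → Prop}

theorem EChain.eq_of_univ {c c' : C} (hc : isE c = false) (h : EChain isE step c c') :
    c' = c := by
  cases h with
  | refl => rfl
  | step h => simp [hc] at h

theorem UChain.eq_of_ex {c c' : C} (hc : isE c = true) (h : UChain isE step c c') :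
    c' = c := by
  cases h with
  | refl => rfl
  | step h => simp [hc] at h

/-- Acceptance propagates backwards along a step out of an existential configuration. -/
theorem Accepted.of_ex_step {c c' : C} (hc : isE c = true) (h : step c c')
    (ha : Accepted isE step c') : Accepted isE step c := by
  cases ha with
  | ex hc' hp ha => exact .ex hc ⟨.step hc h hp.1, hp.2⟩ ha
  | univ hc' hp => exact .ex hc ⟨.step hc h (.refl _), hc'⟩ (.univ hc' hp)

/-- Rejection propagates backwards along a step out of a universal configuration. -/
theorem Rejected.of_univ_step {c c' : C} (hc : isE c = false) (h : step c c')
    (hr : Rejected isE step c') : Rejected isE step c := by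
  cases hr with
  | ex hc' hp => exact .univ hc ⟨.step hc h (.refl _), hc'⟩ (.ex hc' hp)
  | univ hc' hp hr => exact .univ hc ⟨.step hc h hp.1, hp.2⟩ hr

/-- Every universal configuration reached by an existential chain from a rejected
configuration is rejected. -/
theorem Rejected.of_ePivot {c c' : C} (hr : Rejected isE step c)
    (h : EPivot isE step c c') : Rejected isE step c' := by
  cases hr with
  | ex hc hp => exact hp _ h
  | univ hc hp hr =>
    rw [h.1.eq_of_univ hc]
    exact .univ hc hp hr

/-- An existential configuration all of whose successors are rejected is rejected. -/
theorem Rejected.of_forall_step {c : C} (hc : isE c = true)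
    (h : ∀ c', step c c' → Rejected isE step c') : Rejected isE step c := by
  refine .ex hc fun c'' hp => ?_
  obtain ⟨hch, hc''⟩ := hp
  cases hch with
  | refl => simp [hc] at hc''
  | step _ hs hch => exact (h _ hs).of_ePivot ⟨hch, hc''⟩

end Generic

theorem ActStep.write_scan {Γ : Type} (blank : Γ) (t : Tape Γ) :
    ActStep blank (.write t.scan) t t := by
  obtain ⟨u, γ, v⟩ := t
  exact .write u γ γ v

theorem ActStep.eq_of_write_scan {Γ : Type} {blank : Γ} {t t' : Tape Γ}
    (h : ActStep blank (.write t.scan) t t') : t' = t := by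
  obtain ⟨u, γ, v⟩ := t
  cases h
  rfl

variable {α Γ : Type} {M₀ M₁ : ATM α Γ}

/-- The configuration of the combined machine with control `j` made up of a configuration
of each of the two machines. -/
def combineCfg (c₀ : M₀.Cfg) (c₁ : M₁.Cfg) (j : Bool) : (combine M₀ M₁).Cfg :=
  ((c₀.1, c₁.1, j), c₀.2, c₁.2)

theorem cfgE_combineCfg_false (c₀ : M₀.Cfg) (c₁ : M₁.Cfg) :
    (combine M₀ M₁).cfgE (combineCfg c₀ c₁ false) = M₀.cfgE c₀ := rfl

theorem cfgE_combineCfg_true (c₀ : M₀.Cfg) (c₁ : M₁.Cfg) :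
    (combine M₀ M₁).cfgE (combineCfg c₀ c₁ true) = M₁.cfgE c₁ := rfl

theorem yield_combineCfg_false {c₀ : M₀.Cfg} {c₁ : M₁.Cfg} {d : (combine M₀ M₁).Cfg} :
    (combine M₀ M₁).Yield (combineCfg c₀ c₁ false) d ↔
      ∃ c₀', M₀.Yield c₀ c₀' ∧ d = combineCfg c₀' c₁ (M₀.cfgE c₀ || M₀.cfgE c₀') := by
  constructor
  · rintro ⟨a₀, a₁, hδ, h₀, h₁⟩
    obtain ⟨s, t₀, t₁⟩ := d
    rcases hδ with ⟨-, p₀, hp, rfl, hs⟩ | ⟨h, -⟩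
    · refine ⟨(p₀, t₀), ⟨a₀, hp, h₀⟩, ?_⟩
      have ht : t₁ = c₁.2 := h₁.eq_of_write_scan
      subst ht
      simp only at hs
      subst hs
      simp [combineCfg, ATM.cfgE]
    · cases h
  · rintro ⟨c₀', ⟨a, hδ, ha⟩, rfl⟩
    refine ⟨a, .write (Tape.scan c₁.2), .inl ⟨rfl, c₀'.1, hδ, rfl, ?_⟩, ha, .write_scan _ _⟩
    simp [combineCfg, ATM.cfgE]

theorem yield_combineCfg_true (hb : M₀.blank = M₁.blank) {c₀ : M₀.Cfg} {c₁ : M₁.Cfg}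
    {d : (combine M₀ M₁).Cfg} :
    (combine M₀ M₁).Yield (combineCfg c₀ c₁ true) d ↔
      ∃ c₁', M₁.Yield c₁ c₁' ∧ d = combineCfg c₀ c₁' (M₁.cfgE c₁ && M₁.cfgE c₁') := by
  have hb' : (combine M₀ M₁).blank = M₁.blank := hb
  constructor
  · rintro ⟨a₀, a₁, hδ, h₀, h₁⟩
    obtain ⟨s, t₀, t₁⟩ := d
    rcases hδ with ⟨h, -⟩ | ⟨-, p₁, hp, rfl, hs⟩
    · cases h
    · refine ⟨(p₁, t₁), ⟨a₁, hp, hb' ▸ h₁⟩, ?_⟩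
      have ht : t₀ = c₀.2 := h₀.eq_of_write_scan
      subst ht
      simp only at hs
      subst hs
      rfl
  · rintro ⟨c₁', ⟨a, hδ, ha⟩, rfl⟩
    exact ⟨.write (Tape.scan c₀.2), a, .inr ⟨rfl, c₁'.1, hδ, rfl, rfl⟩, .write_scan _ _,
      hb'.symm ▸ ha⟩

/-- `RejectsWith M₀ c₁ j`: the combined machine rejects `c₁` in control `j` paired with any
configuration that `M₀` does not accept. -/
def RejectsWith (M₀ : ATM α Γ) (c₁ : M₁.Cfg) (j : Bool) : Prop :=
  ∀ c₀ : M₀.Cfg, ¬ M₀.Accepted c₀ → (combine M₀ M₁).Rejected (combineCfg c₀ c₁ j)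

/-- A universal chain of `M₀` to an existential configuration lifts to the combined machine in
control `0`, which hands control to `M₁` at the end. -/
theorem rejected_of_uChain {c₀ c₀' : M₀.Cfg} {c₁ : M₁.Cfg}
    (h : UChain M₀.cfgE M₀.Yield c₀ c₀') (hc₀ : M₀.cfgE c₀ = false)
    (hc₀' : M₀.cfgE c₀' = true)
    (hr : (combine M₀ M₁).Rejected (combineCfg c₀' c₁ true)) :
    (combine M₀ M₁).Rejected (combineCfg c₀ c₁ false) := by
  induction h with
  | refl => simp [hc₀] at hc₀'
  | @step c d e _ hs hch ih =>
    have hy : (combine M₀ M₁).Yield (combineCfg c c₁ false)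
        (combineCfg d c₁ (M₀.cfgE c || M₀.cfgE d)) := yield_combineCfg_false.2 ⟨d, hs, rfl⟩
    refine Rejected.of_univ_step hc₀ hy ?_
    cases hd : M₀.cfgE d with
    | false =>
      rw [hc₀]
      exact ih hd hc₀' hr
    | true =>
      rw [hch.eq_of_ex hd] at hr
      rw [hc₀]
      exact hr

theorem RejectsWith.false_of_true {c₁ : M₁.Cfg} (h : RejectsWith M₀ c₁ true) :
    RejectsWith M₀ c₁ false := by
  intro c₀ hc₀
  cases hE : M₀.cfgE c₀ with
  | false =>
    obtain ⟨c₀', hp, hn⟩ : ∃ c₀', UPivot M₀.cfgE M₀.Yield c₀ c₀' ∧ ¬ M₀.Accepted c₀' := by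
      by_contra! hcon
      exact hc₀ (.univ hE hcon)
    exact rejected_of_uChain hp.1 hE hp.2 (h _ hn)
  | true =>
    refine Rejected.of_forall_step hE fun d hd => ?_
    obtain ⟨c₀', hs, rfl⟩ := yield_combineCfg_false.1 hd
    rw [hE]
    exact h _ fun ha => hc₀ (.of_ex_step hE hs ha)

theorem RejectsWith.of_univ_step (hb : M₀.blank = M₁.blank) {c₁ c₁' : M₁.Cfg}
    (hE : M₁.cfgE c₁ = false) (hs : M₁.Yield c₁ c₁') (h : RejectsWith M₀ c₁' true) :
    RejectsWith M₀ c₁ true := by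
  intro c₀ hc₀
  refine Rejected.of_univ_step hE ((yield_combineCfg_true hb).2 ⟨c₁', hs, rfl⟩) ?_
  rw [hE]
  exact h.false_of_true c₀ hc₀

/-- If every existential pivot of the existential configuration `c₁` is rejected together with
all configurations not accepted by `M₀`, then so are the universal configurations at the end
of an existential chain of the combined machine. -/
theorem rejected_of_eChain (hb : M₀.blank = M₁.blank) {c₀ : M₀.Cfg} (hc₀ : ¬ M₀.Accepted c₀)
    {d e : (combine M₀ M₁).Cfg}
    (h : EChain (combine M₀ M₁).cfgE (combine M₀ M₁).Yield d e)
    (he : (combine M₀ M₁).cfgE e = false) {c₁ : M₁.Cfg} (hd : d = combineCfg c₀ c₁ true)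
    (hE : M₁.cfgE c₁ = true)
    (hp : ∀ c₁', EPivot M₁.cfgE M₁.Yield c₁ c₁' → RejectsWith M₀ c₁' true) :
    (combine M₀ M₁).Rejected e := by
  induction h generalizing c₁ with
  | refl =>
    rw [hd, cfgE_combineCfg_true, hE] at he
    cases he
  | step _ hs hch ih =>
    subst hd
    obtain ⟨c₁', hs', rfl⟩ := (yield_combineCfg_true hb).1 hs
    cases hE' : M₁.cfgE c₁' with
    | true =>
      exact ih he (by rw [hE, hE']; rfl) hE' fun c hc => hp c ⟨.step hE hs' hc.1, hc.2⟩
    | false =>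
      rw [hE, hE'] at hch
      exact Rejected.of_ePivot
        ((hp c₁' ⟨.step hE hs' (.refl _), hE'⟩).false_of_true c₀ hc₀) ⟨hch, he⟩

theorem rejectsWith_of_rejected (hb : M₀.blank = M₁.blank) {c₁ : M₁.Cfg}
    (h : M₁.Rejected c₁) : RejectsWith M₀ c₁ true := by
  unfold ATM.Rejected at h
  induction h with
  | ex hE _ ih =>
    exact fun c₀ hc₀ => .ex hE fun e he => rejected_of_eChain hb hc₀ he.1 he.2 rfl hE ih
  | univ _ hp _ ih =>
    obtain ⟨hch, -⟩ := hp
    induction hch with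
    | refl => exact ih
    | step hE hs hch ih' =>
      cases hE' : M₁.cfgE _ with
      | false => exact .of_univ_step hb hE hs (ih' ‹_› ‹_› ih)
      | true => exact .of_univ_step hb hE hs (hch.eq_of_ex hE' ▸ ih)

end ATMPaper

open ATMPaper in
/-- let `M` be the combined two-tape machine of single-tape
machines `M₀`, `M₁` over the same alphabets. If `M₁` rejects `(q₁,u₁)` and
`(q₀,u₀)` is a configuration of `M₀` not accepted by `M₀`, then `M` rejects
`(⟨q₀,q₁,1⟩,⟨u₀,u₁⟩)`. -/
theorem stmt18 {α Γ : Type} (M₀ M₁ : ATM α Γ)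
    (hb : M₀.blank = M₁.blank) (he : ∀ a : α, M₀.emb a = M₁.emb a)
    (q₀ : M₀.Q) (u₀ : Tape Γ) (q₁ : M₁.Q) (u₁ : Tape Γ)
    (h₁ : M₁.Rejected (q₁, u₁)) (h₀ : ¬M₀.Accepted (q₀, u₀)) :
    (combine M₀ M₁).Rejected ((q₀, q₁, true), u₀, u₁) := by
  exact rejectsWith_of_rejected hb h₁ (q₀, u₀) h₀
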